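/- Let γ : [0,1] → ℂ be a continuous loop (γ 0 = γ 1) and let 0 ≤ a < b ≤ 1 satisfy γ a = γ b. Let γ₁ : [0,1] → ℂ be the loop γ₁ t = γ(a + t·(b − a)), and let γ̃ : [0,1] → ℂ be the loop based at γ a = γ b obtained by first traversing γ restricted to [a,b] in reverse (from γ b back to γ a, via t ↦ γ(b − t·(b − a))) and then traversing the remaining part of γ, namely γ on [0,a] preceded by γ on [b,1] (from γ b through γ 1 = γ 0 to γ a). Then for every z ∉ γ '' [0,1], the winding numbers satisfy n(γ̃, z) = n(γ, z) − 2·n(γ₁, z). -/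

import Mathlib

open Set

/-- `IsWindingNumber γ z n` : the winding number of the loop `γ` about `z` is `n`,
expressed via logarithmic lifts: every continuous `ℓ` on `[0,1]` with
`γ t - z = exp (ℓ t)` satisfies `ℓ 1 - ℓ 0 = 2 π i n`. -/
def IsWindingNumber (γ : ℝ → ℂ) (z : ℂ) (n : ℤ) : Prop :=
  ∀ ℓ : ℝ → ℂ, ContinuousOn ℓ (Set.Icc 0 1) →
    (∀ t ∈ Set.Icc (0:ℝ) 1, γ t - z = Complex.exp (ℓ t)) →
    ℓ 1 - ℓ 0 = 2 * Real.pi * Complex.I * n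

theorem exists_log_lift (f : ℝ → ℂ) (hf : ContinuousOn f (Set.Icc 0 1))
    (h0 : ∀ t ∈ Set.Icc (0:ℝ) 1, f t ≠ 0) :
    ∃ L : ℝ → ℂ, Continuous L ∧ ∀ t ∈ Set.Icc (0:ℝ) 1, f t = Complex.exp (L t) := by
  let g : C(unitInterval, {z : ℂ // z ≠ 0}) :=
    ⟨fun t => ⟨f t, h0 t t.2⟩, Continuous.subtype_mk (continuousOn_iff_continuous_domRestrict.1 hf) _⟩
  obtain ⟨Γ, hΓ, -⟩ := Complex.isCoveringMap_exp.exists_path_lifts g (Complex.log (f 0))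
    (by
      apply Subtype.ext
      have := Complex.exp_log (h0 0 (by simp))
      exact this.symm)
  refine ⟨Set.IccExtend zero_le_one Γ, Γ.continuous.Icc_extend', ?_⟩
  intro t ht
  rw [Set.IccExtend_of_mem _ _ ht]
  have := congrArg Subtype.val (congrFun hΓ ⟨t, ht⟩)
  exact this.symm

/- `γt` first traverses `γ|[a,b]` in reverse (on the parameter interval `[0,1/2]`),
then traverses the remaining part of `γ`, namely `γ` on `[b,1]` followed by `γ` on
`[0,a]` (on the parameter interval `[1/2,1]`, wrapping around `1 = 0` using
`γ 1 = γ 0`). -/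
theorem stmt7 (γ γ₁ γt : ℝ → ℂ) (hγ : ContinuousOn γ (Set.Icc 0 1))
    (hloop : γ 0 = γ 1) (a b : ℝ) (ha : 0 ≤ a) (hab : a < b) (hb : b ≤ 1)
    (hval : γ a = γ b)
    (hγ₁ : ∀ t, γ₁ t = γ (a + t * (b - a)))
    (hγt : ∀ t, γt t =
      if t ≤ 1/2 then γ (b - 2 * t * (b - a))
      else if b + (2 * t - 1) * (1 - b + a) ≤ 1 then γ (b + (2 * t - 1) * (1 - b + a))
      else γ (b + (2 * t - 1) * (1 - b + a) - 1)) :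
    ∀ z : ℂ, z ∉ γ '' Set.Icc 0 1 →
      ∀ n m k : ℤ, IsWindingNumber γ z n → IsWindingNumber γ₁ z m →
        IsWindingNumber γt z k → k = n - 2 * m := by
  intro z hz n m k hn hm hk
  obtain ⟨L, hLc, hL⟩ := exists_log_lift (fun t => γ t - z) (hγ.sub continuousOn_const)
    (fun t ht h => hz ⟨t, ht, sub_eq_zero.1 h⟩)
  have Hn := hn L hLc.continuousOn hL
  have hpos : 0 < b - a := sub_pos.2 hab
  have Hm := hm (fun t => L (a + t * (b - a))) (by fun_prop) (by
    intro t ht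
    rw [hγ₁]
    exact hL _ ⟨by nlinarith [ht.1], by nlinarith [ht.2]⟩)
  simp only [one_mul, zero_mul, add_zero, add_sub_cancel] at Hm
  have e1 : Complex.exp (L 1 - L 0) = 1 := by
    rw [Hn, Complex.exp_eq_one_iff]; exact ⟨n, by ring⟩
  have e2 : Complex.exp (L a - L b) = 1 := by
    rw [Complex.exp_eq_one_iff]; exact ⟨-m, by push_cast; linear_combination -Hm⟩
  have hfin := hk (fun t => if t ≤ 1/2 then L (b - 2 * t * (b - a))
      else (if b + (2 * t - 1) * (1 - b + a) ≤ 1 then L (b + (2 * t - 1) * (1 - b + a))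
      else L (b + (2 * t - 1) * (1 - b + a) - 1) + (L 1 - L 0)) + (L a - L b)) (by
    apply Continuous.continuousOn
    refine Continuous.if_le (by fun_prop) (Continuous.add (Continuous.if_le (by fun_prop) (by fun_prop) (by fun_prop) (by fun_prop) ?_) (by fun_prop)) (by fun_prop) (by fun_prop) ?_
    · intro t ht
      rw [ht]; simp
    · intro t ht
      subst ht
      norm_num [hb]) (by
    intro t ht
    have hc : 0 ≤ 1 - b + a := by linarith
    rw [hγt]
    split_ifs with h1 h2
    · exact hL _ ⟨by nlinarith [ht.1], by nlinarith [ht.1]⟩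
    · rw [Complex.exp_add, e2, mul_one]
      push Not at h1
      exact hL _ ⟨by nlinarith [ht.1], h2⟩
    · rw [Complex.exp_add, Complex.exp_add, e1, e2, mul_one, mul_one]
      push Not at h1 h2
      exact hL _ ⟨by linarith, by nlinarith [ht.2]⟩)
  have hend : (if b + (2 * (1:ℝ) - 1) * (1 - b + a) ≤ 1 then L (b + (2 * 1 - 1) * (1 - b + a))
      else L (b + (2 * 1 - 1) * (1 - b + a) - 1) + (L 1 - L 0)) = L a + (L 1 - L 0) := by
    have hs : b + (2 * (1:ℝ) - 1) * (1 - b + a) = 1 + a := by ring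
    rw [hs]
    split_ifs with h
    · have : a = 0 := by linarith
      subst this; simp
    · simp
  rw [hend, if_neg (by norm_num), if_pos (by norm_num)] at hfin
  simp only [mul_zero, zero_mul, sub_zero] at hfin
  have key : (2 * Real.pi * Complex.I : ℂ) * k = 2 * Real.pi * Complex.I * ((n - 2 * m : ℤ) : ℂ) := by
    push_cast
    linear_combination Hn - 2 * Hm - hfin
  have := mul_left_cancel₀ Complex.two_pi_I_ne_zero key
  exact_mod_cast this
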